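/- (Theorem 1: universal shifted asymptotic stability of the closed loop.) Let f : ℝ^{n_x} × ℝ^{n_u} → ℝ^{n_x} be continuously differentiable. Assume: (a) there are continuous basis functions ψ = (ψ_1,…,ψ_{n_p}) : (ℝ^{n_x}×ℝ^{n_u})² → ℝ^{n_p} and matrices A₀,…,A_{n_p}, B₀,…,B_{n_p} such that A_v(x,u,x',u') = A₀ + Σ_i A_i ψ_i(x,u,x',u') and B_v(x,u,x',u') = B₀ + Σ_i B_i ψ_i(x,u,x',u') for all arguments, and the image of ψ is contained in a compact set 𝒫 ⊂ ℝ^{n_p}; (b) K(p) = K₀ + Σ_{i=1}^{n_p} p_i K_i with K_i ∈ ℝ^{n_u×n_x}, and there exists a symmetric positive definite P ∈ ℝ^{n_x×n_x} with (Ā(p)+B̄(p)K(p))ᵀ P (Ā(p)+B̄(p)K(p)) − P negative definite for every p ∈ 𝒫, where Ā(p) = A₀ + Σ_i p_i A_i, B̄(p) = B₀ + Σ_i p_i B_i. Consider the closed loop x_{k+1} = f(x_k,u_k), u_k = u_{k−1} + K(ψ(x_k,u_k,x_{k−1},u_{k−1}))(x_k − x_{k−1}). Then there exist c ≥ 1 and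 λ ∈ (0,1) such that along every closed-loop trajectory ‖x_k − x_{k−1}‖ ≤ c λ^{k−k₀} ‖x_{k₀} − x_{k₀−1}‖ for all k ≥ k₀; every closed-loop trajectory converges to a forced equilibrium of f; and for every forced equilibrium (x*,u*) and every ε > 0 there is δ > 0 such that any closed-loop trajectory with x_{k₀−1} = x*, u_{k₀−1} = u* and ‖x_{k₀} − x*‖ ≤ δ satisfies ‖x_k − x*‖ ≤ ε for all k ≥ k₀ and x_k → x*. -/

import Mathlib

open Matrix MeasureTheory

/-- Partial Jacobian of `f : ℝ^n × ℝ^m → ℝ^n` with respect to its first argument. -/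
noncomputable def Jx {n m : ℕ} (f : (Fin n → ℝ) × (Fin m → ℝ) → Fin n → ℝ)
    (x : Fin n → ℝ) (u : Fin m → ℝ) : Matrix (Fin n) (Fin n) ℝ :=
  Matrix.of fun i j => fderiv ℝ f (x, u) (Pi.single j 1, 0) i

/-- Partial Jacobian of `f : ℝ^n × ℝ^m → ℝ^n` with respect to its second argument. -/
noncomputable def Ju {n m : ℕ} (f : (Fin n → ℝ) × (Fin m → ℝ) → Fin n → ℝ)
    (x : Fin n → ℝ) (u : Fin m → ℝ) : Matrix (Fin n) (Fin m) ℝ :=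
  Matrix.of fun i j => fderiv ℝ f (x, u) (0, Pi.single j 1) i

/-- Velocity matrix `A_v(x,u,x',u') = ∫₀¹ ∂f/∂x (x' + λ(x−x'), u' + λ(u−u')) dλ`
(entrywise integral). -/
noncomputable def Av {n m : ℕ} (f : (Fin n → ℝ) × (Fin m → ℝ) → Fin n → ℝ)
    (x : Fin n → ℝ) (u : Fin m → ℝ) (x' : Fin n → ℝ) (u' : Fin m → ℝ) :
    Matrix (Fin n) (Fin n) ℝ :=
  Matrix.of fun i j => ∫ l in (0:ℝ)..1, Jx f (x' + l • (x - x')) (u' + l • (u - u')) i j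

/-- Velocity matrix `B_v(x,u,x',u') = ∫₀¹ ∂f/∂u (x' + λ(x−x'), u' + λ(u−u')) dλ`
(entrywise integral). -/
noncomputable def Bv {n m : ℕ} (f : (Fin n → ℝ) × (Fin m → ℝ) → Fin n → ℝ)
    (x : Fin n → ℝ) (u : Fin m → ℝ) (x' : Fin n → ℝ) (u' : Fin m → ℝ) :
    Matrix (Fin n) (Fin m) ℝ :=
  Matrix.of fun i j => ∫ l in (0:ℝ)..1, Ju f (x' + l • (x - x')) (u' + l • (u - u')) i j

/-- Affine scheduling-dependent matrix `Ā(p) = A₀ + Σᵢ pᵢ Aᵢ`. -/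
def Abar {nx np : ℕ} (A0 : Matrix (Fin nx) (Fin nx) ℝ)
    (A : Fin np → Matrix (Fin nx) (Fin nx) ℝ) (p : Fin np → ℝ) :
    Matrix (Fin nx) (Fin nx) ℝ :=
  A0 + ∑ i, p i • A i

/-- Affine scheduling-dependent matrix `B̄(p) = B₀ + Σᵢ pᵢ Bᵢ`. -/
def Bbar {nx nu np : ℕ} (B0 : Matrix (Fin nx) (Fin nu) ℝ)
    (B : Fin np → Matrix (Fin nx) (Fin nu) ℝ) (p : Fin np → ℝ) :
    Matrix (Fin nx) (Fin nu) ℝ :=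
  B0 + ∑ i, p i • B i

/-- The Euclidean norm on `ℝ^n` (represented as `Fin n → ℝ`). -/
noncomputable def eunorm {n : ℕ} (v : Fin n → ℝ) : ℝ := Real.sqrt (∑ i, v i ^ 2)

/-- A real symmetric matrix is negative definite if `vᵀSv < 0` for all `v ≠ 0`. -/
def NegDefR {n : ℕ} (S : Matrix (Fin n) (Fin n) ℝ) : Prop :=
  S.IsHermitian ∧ ∀ v : Fin n → ℝ, v ≠ 0 → v ⬝ᵥ S.mulVec v < 0

/-- The Jacobian of `f` applied to a direction splits into the two partial Jacobians. -/
lemma fderiv_apply_eq_Jx_add_Ju {n m : ℕ} (f : (Fin n → ℝ) × (Fin m → ℝ) → Fin n → ℝ)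
    (x : Fin n → ℝ) (u : Fin m → ℝ) (v : Fin n → ℝ) (w : Fin m → ℝ) (i : Fin n) :
    fderiv ℝ f (x, u) (v, w) i = ∑ j, Jx f x u i j * v j + ∑ j, Ju f x u i j * w j := by
  have hv : (v, (0 : Fin m → ℝ)) = ∑ j, v j • ((Pi.single j 1, 0) : (Fin n → ℝ) × (Fin m → ℝ)) := by
    ext k
    · simp [Prod.fst_sum, Finset.sum_apply, Pi.single_apply]
    · simp [Prod.snd_sum]
  have hw : ((0 : Fin n → ℝ), w) = ∑ j, w j • ((0, Pi.single j 1) : (Fin n → ℝ) × (Fin m → ℝ)) := by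
    ext k
    · simp [Prod.fst_sum]
    · simp [Prod.snd_sum, Finset.sum_apply, Pi.single_apply]
  have hvw : (v, w) = (v, (0 : Fin m → ℝ)) + ((0 : Fin n → ℝ), w) := by simp
  rw [hvw, map_add, hv, hw, map_sum, map_sum]
  simp only [map_smul, Pi.add_apply, Finset.sum_apply, Pi.smul_apply, smul_eq_mul, Jx, Ju,
    Matrix.of_apply, mul_comm]

lemma continuous_Jx {n m : ℕ} {f : (Fin n → ℝ) × (Fin m → ℝ) → Fin n → ℝ}
    (hf : ContDiff ℝ 1 f) (i j : Fin n) :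
    Continuous fun z : (Fin n → ℝ) × (Fin m → ℝ) => Jx f z.1 z.2 i j := by
  have h := hf.continuous_fderiv one_ne_zero
  simp only [Jx, Matrix.of_apply]
  fun_prop

lemma continuous_Ju {n m : ℕ} {f : (Fin n → ℝ) × (Fin m → ℝ) → Fin n → ℝ}
    (hf : ContDiff ℝ 1 f) (i : Fin n) (j : Fin m) :
    Continuous fun z : (Fin n → ℝ) × (Fin m → ℝ) => Ju f z.1 z.2 i j := by
  have h := hf.continuous_fderiv one_ne_zero
  simp only [Ju, Matrix.of_apply]
  fun_prop

/-- The increments of a `C¹` map are represented exactly by the velocity matrices. -/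
lemma sub_eq_Av_mulVec_add_Bv_mulVec {n m : ℕ} {f : (Fin n → ℝ) × (Fin m → ℝ) → Fin n → ℝ}
    (hf : ContDiff ℝ 1 f) (x : Fin n → ℝ) (u : Fin m → ℝ) (x' : Fin n → ℝ) (u' : Fin m → ℝ) :
    f (x, u) - f (x', u') =
      (Av f x u x' u').mulVec (x - x') + (Bv f x u x' u').mulVec (u - u') := by
  ext i
  have hJx : ∀ j, Continuous fun l : ℝ =>
      Jx f (x' + l • (x - x')) (u' + l • (u - u')) i j := fun j =>
    (continuous_Jx hf i j).comp
      (g := fun z : (Fin n → ℝ) × (Fin m → ℝ) => Jx f z.1 z.2 i j)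
      (f := fun l : ℝ => (x' + l • (x - x'), u' + l • (u - u'))) (by fun_prop)
  have hJu : ∀ j, Continuous fun l : ℝ =>
      Ju f (x' + l • (x - x')) (u' + l • (u - u')) i j := fun j =>
    (continuous_Ju hf i j).comp
      (g := fun z : (Fin n → ℝ) × (Fin m → ℝ) => Ju f z.1 z.2 i j)
      (f := fun l : ℝ => (x' + l • (x - x'), u' + l • (u - u'))) (by fun_prop)
  have hderiv : ∀ l : ℝ, HasDerivAt (fun l : ℝ => f (x' + l • (x - x'), u' + l • (u - u')) i)
      (∑ j, Jx f (x' + l • (x - x')) (u' + l • (u - u')) i j * (x - x') j +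
        ∑ j, Ju f (x' + l • (x - x')) (u' + l • (u - u')) i j * (u - u') j) l := by
    intro l
    rw [← fderiv_apply_eq_Jx_add_Ju]
    have hline : HasDerivAt (fun l : ℝ => (x' + l • (x - x'), u' + l • (u - u')))
        (x - x', u - u') l := by
      have hx := ((hasDerivAt_id l).smul_const (x - x')).const_add x'
      have hu := ((hasDerivAt_id l).smul_const (u - u')).const_add u'
      simpa using hx.prodMk hu
    have hfd := (hf.differentiable one_ne_zero
      (x' + l • (x - x'), u' + l • (u - u'))).hasFDerivAt
    exact hasDerivAt_pi.1 (hfd.comp_hasDerivAt l hline) i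
  have hint := intervalIntegral.integral_eq_sub_of_hasDerivAt (a := 0) (b := 1)
    (fun l _ => hderiv l) (Continuous.intervalIntegrable (by fun_prop) _ _)
  rw [intervalIntegral.integral_add (Continuous.intervalIntegrable (by fun_prop) _ _)
      (Continuous.intervalIntegrable (by fun_prop) _ _),
    intervalIntegral.integral_finsetSum
      (fun j _ => Continuous.intervalIntegrable (by fun_prop) _ _),
    intervalIntegral.integral_finsetSum
      (fun j _ => Continuous.intervalIntegrable (by fun_prop) _ _)] at hint
  simp only [intervalIntegral.integral_mul_const] at hint
  simpa [Matrix.mulVec, dotProduct, Av, Bv] using hint.symm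

/-- Comparison of two families of degree-two homogeneous functions over a compact parameter set:
the ratio `g / h` attains its maximum. -/
lemma exists_mul_bound_of_homogeneous {X : Type*} [TopologicalSpace X] {n : ℕ} {S : Set X}
    (hS : IsCompact S) {g : X → (Fin n → ℝ) → ℝ} {h : (Fin n → ℝ) → ℝ}
    (hg : Continuous fun q : X × (Fin n → ℝ) => g q.1 q.2) (hh : Continuous h)
    (hg2 : ∀ p (t : ℝ) v, g p (t • v) = t ^ 2 * g p v)
    (hh2 : ∀ (t : ℝ) v, h (t • v) = t ^ 2 * h v)
    (hpos : ∀ v, v ≠ 0 → 0 < h v) {b : ℝ} (hb : 0 < b)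
    (hlt : ∀ p ∈ S, ∀ v, v ≠ 0 → g p v < b * h v) :
    ∃ r, 0 < r ∧ r < b ∧ ∀ p ∈ S, ∀ v, g p v ≤ r * h v := by
  have hne : ∀ v ∈ Metric.sphere (0 : Fin n → ℝ) 1, v ≠ 0 := by
    rintro v hv rfl
    simp at hv
  obtain ⟨r, hr0, hrb, hr⟩ : ∃ r, 0 < r ∧ r < b ∧ ∀ p ∈ S,
      ∀ v ∈ Metric.sphere (0 : Fin n → ℝ) 1, g p v ≤ r * h v := by
    rcases (S ×ˢ Metric.sphere (0 : Fin n → ℝ) 1).eq_empty_or_nonempty with he | he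
    · refine ⟨b / 2, by linarith, by linarith, fun p hp v hv => ?_⟩
      have : (p, v) ∈ S ×ˢ Metric.sphere (0 : Fin n → ℝ) 1 := ⟨hp, hv⟩
      simp [he] at this
    · have hcont : ContinuousOn (fun q : X × (Fin n → ℝ) => g q.1 q.2 / h q.2)
          (S ×ˢ Metric.sphere (0 : Fin n → ℝ) 1) :=
        hg.continuousOn.div (hh.comp continuous_snd).continuousOn
          fun q hq => (hpos _ (hne _ hq.2)).ne'
      obtain ⟨q, hq, hmax⟩ := (hS.prod (isCompact_sphere _ _)).exists_isMaxOn he hcont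
      refine ⟨max (b / 2) (g q.1 q.2 / h q.2), lt_max_of_lt_left (by linarith),
        max_lt (by linarith) ?_, fun p hp v hv => ?_⟩
      · rw [div_lt_iff₀ (hpos _ (hne _ hq.2))]
        exact hlt _ hq.1 _ (hne _ hq.2)
      · rw [← div_le_iff₀ (hpos _ (hne _ hv))]
        exact le_max_of_le_right (hmax (a := (p, v)) ⟨hp, hv⟩)
  refine ⟨r, hr0, hrb, fun p hp v => ?_⟩
  rcases eq_or_ne v 0 with rfl | hv
  · have h1 := hg2 p 0 0
    have h2 := hh2 0 0
    simp only [smul_zero, ne_eq, OfNat.ofNat_ne_zero, not_false_eq_true, zero_pow,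
      zero_mul] at h1 h2
    simp [h1, h2]
  · have hv' : ‖v‖ ≠ 0 := norm_ne_zero_iff.2 hv
    have hs : v = ‖v‖ • (‖v‖⁻¹ • v) := by rw [smul_smul, mul_inv_cancel₀ hv', one_smul]
    have := hr p hp (‖v‖⁻¹ • v) (by simp [norm_smul, hv'])
    rw [hs, hg2, hh2]
    nlinarith [mul_le_mul_of_nonneg_left this (sq_nonneg ‖v‖)]

/-- A continuous family of degree-two homogeneous functions over a compact parameter set is
dominated by a multiple of any positive one. -/
lemma exists_bound_of_homogeneous {X : Type*} [TopologicalSpace X] {n : ℕ} {S : Set X}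
    (hS : IsCompact S) {g : X → (Fin n → ℝ) → ℝ} {h : (Fin n → ℝ) → ℝ}
    (hg : Continuous fun q : X × (Fin n → ℝ) => g q.1 q.2) (hh : Continuous h)
    (hg2 : ∀ p (t : ℝ) v, g p (t • v) = t ^ 2 * g p v)
    (hh2 : ∀ (t : ℝ) v, h (t • v) = t ^ 2 * h v)
    (hpos : ∀ v, v ≠ 0 → 0 < h v) :
    ∃ r, 0 < r ∧ ∀ p ∈ S, ∀ v, g p v ≤ r * h v := by
  have hne : ∀ v ∈ Metric.sphere (0 : Fin n → ℝ) 1, v ≠ 0 := by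
    rintro v hv rfl
    simp at hv
  have hcont : ContinuousOn (fun q : X × (Fin n → ℝ) => g q.1 q.2 / h q.2)
      (S ×ˢ Metric.sphere (0 : Fin n → ℝ) 1) :=
    hg.continuousOn.div (hh.comp continuous_snd).continuousOn
      fun q hq => (hpos _ (hne _ hq.2)).ne'
  obtain ⟨C, hC⟩ := ((hS.prod (isCompact_sphere _ _)).image_of_continuousOn hcont).bddAbove
  have hlt : ∀ p ∈ S, ∀ v, v ≠ 0 → g p v < (max C 0 + 1) * h v := by
    intro p hp v hv
    have hv' : ‖v‖ ≠ 0 := norm_ne_zero_iff.2 hv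
    have hmem : ‖v‖⁻¹ • v ∈ Metric.sphere (0 : Fin n → ℝ) 1 := by simp [norm_smul, hv']
    have hle := hC ⟨(p, ‖v‖⁻¹ • v), ⟨hp, hmem⟩, rfl⟩
    simp only [hg2, hh2] at hle
    rw [mul_div_mul_left _ _ (by positivity)] at hle
    rw [← div_lt_iff₀ (hpos v hv)]
    linarith [le_max_left C 0]
  obtain ⟨r, hr0, -, hr⟩ := exists_mul_bound_of_homogeneous hS hg hh hg2 hh2 hpos
    (b := max C 0 + 1) (by positivity) hlt
  exact ⟨r, hr0, hr⟩

lemma eunorm_nonneg {n : ℕ} (v : Fin n → ℝ) : 0 ≤ eunorm v := Real.sqrt_nonneg _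

lemma eunorm_sq {n : ℕ} (v : Fin n → ℝ) : eunorm v ^ 2 = v ⬝ᵥ v := by
  rw [eunorm, Real.sq_sqrt (Finset.sum_nonneg fun i _ => sq_nonneg _)]
  simp [dotProduct, sq]

lemma norm_le_eunorm {n : ℕ} (v : Fin n → ℝ) : ‖v‖ ≤ eunorm v := by
  refine (pi_norm_le_iff_of_nonneg (eunorm_nonneg v)).2 fun i => ?_
  rw [Real.norm_eq_abs]
  exact Real.abs_le_sqrt (Finset.single_le_sum (f := fun i => v i ^ 2)
    (fun i _ => sq_nonneg _) (Finset.mem_univ i))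

lemma eunorm_zero {n : ℕ} : eunorm (0 : Fin n → ℝ) = 0 := by simp [eunorm]

lemma eq_zero_of_eunorm_nonpos {n : ℕ} {v : Fin n → ℝ} (h : eunorm v ≤ 0) : v = 0 :=
  norm_le_zero_iff.1 ((norm_le_eunorm v).trans h)

lemma dotProduct_mulVec_smul {n : ℕ} (Q : Matrix (Fin n) (Fin n) ℝ) (t : ℝ) (v : Fin n → ℝ) :
    (t • v) ⬝ᵥ Q.mulVec (t • v) = t ^ 2 * (v ⬝ᵥ Q.mulVec v) := by
  simp [Matrix.mulVec_smul]
  ring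

lemma dotProduct_transpose_mul_mul_mulVec {n : ℕ} (M P : Matrix (Fin n) (Fin n) ℝ)
    (v : Fin n → ℝ) : v ⬝ᵥ (Mᵀ * P * M).mulVec v = M.mulVec v ⬝ᵥ P.mulVec (M.mulVec v) := by
  rw [← Matrix.mulVec_mulVec, ← Matrix.mulVec_mulVec, Matrix.dotProduct_mulVec,
    Matrix.vecMul_transpose]

/-- A common strict quadratic Lyapunov function over a compact parameter set makes every
time-varying linear recursion with matrices from the family uniformly exponentially stable. -/
lemma exists_geometric_decay {X : Type*} [TopologicalSpace X] {n : ℕ} {S : Set X}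
    (hS : IsCompact S) {M : X → Matrix (Fin n) (Fin n) ℝ} (hM : Continuous M)
    {P : Matrix (Fin n) (Fin n) ℝ} (hP : P.PosDef)
    (hneg : ∀ p ∈ S, NegDefR ((M p)ᵀ * P * M p - P)) :
    ∃ c : ℝ, 1 ≤ c ∧ ∃ l : ℝ, l ∈ Set.Ioo (0 : ℝ) 1 ∧
      ∀ d : ℕ → Fin n → ℝ, (∀ k, ∃ p ∈ S, d (k + 1) = (M p).mulVec (d k)) →
        ∀ k, eunorm (d k) ≤ c * l ^ k * eunorm (d 0) := by
  have hVpos : ∀ v : Fin n → ℝ, v ≠ 0 → 0 < v ⬝ᵥ P.mulVec v := fun v hv => by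
    simpa using hP.dotProduct_mulVec_pos hv
  have hdpos : ∀ v : Fin n → ℝ, v ≠ 0 → 0 < v ⬝ᵥ v := fun v hv => by
    simpa using Matrix.dotProduct_star_self_pos_iff.2 hv
  have hd2 : ∀ (t : ℝ) (v : Fin n → ℝ), (t • v) ⬝ᵥ (t • v) = t ^ 2 * (v ⬝ᵥ v) := by
    intro t v
    simpa using dotProduct_mulVec_smul 1 t v
  have hVcont : Continuous fun v : Fin n → ℝ => v ⬝ᵥ P.mulVec v := by fun_prop
  have hdcont : Continuous fun v : Fin n → ℝ => v ⬝ᵥ v := by fun_prop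
  obtain ⟨r, hr0, hr1, hr⟩ := exists_mul_bound_of_homogeneous hS
    (g := fun p v => v ⬝ᵥ ((M p)ᵀ * P * M p).mulVec v) (h := fun v => v ⬝ᵥ P.mulVec v)
    (by fun_prop) hVcont (fun p t v => dotProduct_mulVec_smul _ t v)
    (fun t v => dotProduct_mulVec_smul _ t v) hVpos one_pos
    (fun p hp v hv => by
      have := (hneg p hp).2 v hv
      rw [Matrix.sub_mulVec, dotProduct_sub] at this
      linarith)
  obtain ⟨a, ha0, ha⟩ := exists_bound_of_homogeneous (X := Unit) isCompact_univ
    (g := fun _ v => v ⬝ᵥ v) (h := fun v : Fin n → ℝ => v ⬝ᵥ P.mulVec v)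
    (by fun_prop) hVcont (fun _ => hd2) (fun t v => dotProduct_mulVec_smul _ t v) hVpos
  obtain ⟨b, hb0, hb⟩ := exists_bound_of_homogeneous (X := Unit) isCompact_univ
    (g := fun _ v => v ⬝ᵥ P.mulVec v) (h := fun v : Fin n → ℝ => v ⬝ᵥ v)
    (by fun_prop) hdcont (fun _ t v => dotProduct_mulVec_smul _ t v) hd2 hdpos
  refine ⟨max 1 √(a * b), le_max_left _ _, √r, ⟨Real.sqrt_pos.2 hr0, ?_⟩, fun d hd k => ?_⟩
  · rw [Real.sqrt_lt' one_pos]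
    simpa using hr1
  have hV : d k ⬝ᵥ P.mulVec (d k) ≤ r ^ k * (d 0 ⬝ᵥ P.mulVec (d 0)) := by
    induction k with
    | zero => simp
    | succ k ih =>
      obtain ⟨p, hp, hk⟩ := hd k
      calc d (k + 1) ⬝ᵥ P.mulVec (d (k + 1)) ≤ r * (d k ⬝ᵥ P.mulVec (d k)) := by
            rw [hk, ← dotProduct_transpose_mul_mul_mulVec]
            exact hr p hp (d k)
        _ ≤ r * (r ^ k * (d 0 ⬝ᵥ P.mulVec (d 0))) := by gcongr
        _ = r ^ (k + 1) * (d 0 ⬝ᵥ P.mulVec (d 0)) := by ring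
  have hsq : eunorm (d k) ^ 2 ≤ (√(a * b) * √r ^ k * eunorm (d 0)) ^ 2 := by
    calc eunorm (d k) ^ 2 = d k ⬝ᵥ d k := eunorm_sq _
      _ ≤ a * (d k ⬝ᵥ P.mulVec (d k)) := ha () trivial _
      _ ≤ a * (r ^ k * (b * (d 0 ⬝ᵥ d 0))) := by
          have := hb () trivial (d 0)
          gcongr
          exact hV.trans (by gcongr)
      _ = (√(a * b) * √r ^ k * eunorm (d 0)) ^ 2 := by
          rw [mul_pow, mul_pow, eunorm_sq, Real.sq_sqrt (by positivity), ← pow_mul,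
            mul_comm k 2, pow_mul, Real.sq_sqrt hr0.le]
          ring
  calc eunorm (d k) ≤ √(a * b) * √r ^ k * eunorm (d 0) :=
        le_of_sq_le_sq hsq (by have := eunorm_nonneg (d 0); positivity)
    _ ≤ max 1 √(a * b) * √r ^ k * eunorm (d 0) := by
        have := eunorm_nonneg (d 0)
        gcongr
        exact le_max_right _ _

/-- A continuous family of matrices is uniformly bounded over a compact parameter set. -/
lemma exists_norm_mulVec_le {X : Type*} [TopologicalSpace X] {m n : ℕ} {S : Set X}
    (hS : IsCompact S) {M : X → Matrix (Fin m) (Fin n) ℝ} (hM : Continuous M) :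
    ∃ C : ℝ, ∀ p ∈ S, ∀ v, ‖(M p).mulVec v‖ ≤ C * eunorm v := by
  have hd2 : ∀ {n : ℕ} (t : ℝ) (v : Fin n → ℝ), (t • v) ⬝ᵥ (t • v) = t ^ 2 * (v ⬝ᵥ v) := by
    intro n t v
    simpa using dotProduct_mulVec_smul 1 t v
  obtain ⟨C, hC0, hC⟩ := exists_bound_of_homogeneous hS
    (g := fun p v => (M p).mulVec v ⬝ᵥ (M p).mulVec v) (h := fun v => v ⬝ᵥ v)
    (by fun_prop) (by fun_prop) (fun p t v => by rw [Matrix.mulVec_smul, hd2]) hd2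
    (fun v hv => by simpa using Matrix.dotProduct_star_self_pos_iff.2 hv)
  refine ⟨√C, fun p hp v => (norm_le_eunorm _).trans ?_⟩
  refine le_of_sq_le_sq ?_ (mul_nonneg (Real.sqrt_nonneg _) (eunorm_nonneg v))
  rw [mul_pow, eunorm_sq, eunorm_sq, Real.sq_sqrt hC0.le]
  exact hC p hp v

open Filter in
/-- (Theorem 1: universal shifted asymptotic stability of the
closed loop.)  Under (a) an exact affine LPV decomposition of the velocity matrices
over continuous basis functions `ψ` with image in a compact set `𝒫`, and (b) a
quadratic Lyapunov certificate for the scheduled closed-loop velocity matrix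
`Ā(p)+B̄(p)K(p)` over `𝒫`, the closed loop
`x_{k+1} = f(x_k,u_k)`, `u_k = u_{k−1} + K(ψ(x_k,u_k,x_{k−1},u_{k−1}))(x_k − x_{k−1})`
enjoys: geometric decay of the state increments, convergence of every trajectory to a
forced equilibrium, and Lyapunov stability + attractivity w.r.t. every forced
equilibrium (universal shifted asymptotic stability). -/
theorem stmt_13 {nx nu np : ℕ}
    (f : (Fin nx → ℝ) × (Fin nu → ℝ) → Fin nx → ℝ) (hf : ContDiff ℝ 1 f)
    (ψ : (Fin nx → ℝ) → (Fin nu → ℝ) → (Fin nx → ℝ) → (Fin nu → ℝ) → Fin np → ℝ)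
    (hψcont : Continuous fun q : ((Fin nx → ℝ) × (Fin nu → ℝ)) ×
        ((Fin nx → ℝ) × (Fin nu → ℝ)) => ψ q.1.1 q.1.2 q.2.1 q.2.2)
    (A0 : Matrix (Fin nx) (Fin nx) ℝ) (A : Fin np → Matrix (Fin nx) (Fin nx) ℝ)
    (B0 : Matrix (Fin nx) (Fin nu) ℝ) (B : Fin np → Matrix (Fin nx) (Fin nu) ℝ)
    (hA : ∀ x u x' u', Av f x u x' u' = Abar A0 A (ψ x u x' u'))
    (hB : ∀ x u x' u', Bv f x u x' u' = Bbar B0 B (ψ x u x' u'))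
    (Pcal : Set (Fin np → ℝ)) (hPcal : IsCompact Pcal)
    (hψP : ∀ x u x' u', ψ x u x' u' ∈ Pcal)
    (K0 : Matrix (Fin nu) (Fin nx) ℝ) (K : Fin np → Matrix (Fin nu) (Fin nx) ℝ)
    (P : Matrix (Fin nx) (Fin nx) ℝ) (hP : P.PosDef)
    (hLyap : ∀ p ∈ Pcal,
      NegDefR ((Abar A0 A p + Bbar B0 B p * (K0 + ∑ i, p i • K i))ᵀ * P *
        (Abar A0 A p + Bbar B0 B p * (K0 + ∑ i, p i • K i)) - P)) :
    ∃ c : ℝ, 1 ≤ c ∧ ∃ l : ℝ, l ∈ Set.Ioo (0 : ℝ) 1 ∧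
      ((∀ (x : ℕ → Fin nx → ℝ) (u : ℕ → Fin nu → ℝ),
        (∀ k, x (k + 1) = f (x k, u k)) →
        (∀ k, 1 ≤ k → u k = u (k - 1) +
          (K0 + ∑ i, ψ (x k) (u k) (x (k - 1)) (u (k - 1)) i • K i).mulVec
            (x k - x (k - 1))) →
        (∀ k₀, 1 ≤ k₀ → ∀ k, k₀ ≤ k →
          eunorm (x k - x (k - 1)) ≤
            c * l ^ (k - k₀) * eunorm (x k₀ - x (k₀ - 1))) ∧
        ∃ (xlim : Fin nx → ℝ) (ulim : Fin nu → ℝ),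
          Tendsto x atTop (nhds xlim) ∧ Tendsto u atTop (nhds ulim) ∧
          xlim = f (xlim, ulim)) ∧
      (∀ (xs : Fin nx → ℝ) (us : Fin nu → ℝ), xs = f (xs, us) →
        ∀ ε : ℝ, 0 < ε → ∃ δ : ℝ, 0 < δ ∧
          ∀ (x : ℕ → Fin nx → ℝ) (u : ℕ → Fin nu → ℝ) (k₀ : ℕ),
            (∀ k, x (k + 1) = f (x k, u k)) →
            (∀ k, 1 ≤ k → u k = u (k - 1) +
              (K0 + ∑ i, ψ (x k) (u k) (x (k - 1)) (u (k - 1)) i • K i).mulVec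
                (x k - x (k - 1))) →
            1 ≤ k₀ → x (k₀ - 1) = xs → u (k₀ - 1) = us →
            eunorm (x k₀ - xs) ≤ δ →
            (∀ k, k₀ ≤ k → eunorm (x k - xs) ≤ ε) ∧
            Tendsto x atTop (nhds xs))) := by
  have hKc : Continuous fun p : Fin np → ℝ => K0 + ∑ i, p i • K i := by fun_prop
  have hMc : Continuous fun p : Fin np → ℝ =>
      Abar A0 A p + Bbar B0 B p * (K0 + ∑ i, p i • K i) := by
    unfold Abar Bbar
    fun_prop
  obtain ⟨c, hc, l, hl, hdecay⟩ := exists_geometric_decay hPcal hMc hP hLyap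
  obtain ⟨C, hC⟩ := exists_norm_mulVec_le hPcal hKc
  have key : ∀ (x : ℕ → Fin nx → ℝ) (u : ℕ → Fin nu → ℝ),
      (∀ k, x (k + 1) = f (x k, u k)) →
      (∀ k, 1 ≤ k → u k = u (k - 1) +
        (K0 + ∑ i, ψ (x k) (u k) (x (k - 1)) (u (k - 1)) i • K i).mulVec
          (x k - x (k - 1))) →
      ∀ k₀, 1 ≤ k₀ → ∀ k, k₀ ≤ k →
        eunorm (x k - x (k - 1)) ≤ c * l ^ (k - k₀) * eunorm (x k₀ - x (k₀ - 1)) := by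
    intro x u hx hu k₀ hk₀ k hk
    obtain ⟨j, rfl⟩ := Nat.exists_eq_add_of_le hk
    have h := hdecay (fun j => x (k₀ + j) - x (k₀ + j - 1)) (fun j => ?_) j
    · simpa using h
    refine ⟨_, hψP (x (k₀ + j)) (u (k₀ + j)) (x (k₀ + j - 1)) (u (k₀ + j - 1)), ?_⟩
    have hu' := sub_eq_iff_eq_add'.2 (hu (k₀ + j) (by omega))
    have hx' : x (k₀ + j) = f (x (k₀ + j - 1), u (k₀ + j - 1)) := by
      rw [← hx, Nat.sub_add_cancel (by omega)]
    have hstep := sub_eq_Av_mulVec_add_Bv_mulVec hf (x (k₀ + j)) (u (k₀ + j))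
      (x (k₀ + j - 1)) (u (k₀ + j - 1))
    rw [← hx, ← hx', hu', hA, hB, Matrix.mulVec_mulVec, ← Matrix.add_mulVec] at hstep
    exact hstep
  refine ⟨c, hc, l, hl, fun x u hx hu => ⟨key x u hx hu, ?_⟩, ?_⟩
  · have hkey := key x u hx hu 1 le_rfl
    have hxc : CauchySeq x := by
      refine cauchySeq_of_le_geometric l (c * eunorm (x 1 - x 0)) hl.2 fun k => ?_
      rw [dist_comm, dist_eq_norm]
      have := (norm_le_eunorm _).trans (hkey (k + 1) (by omega))
      simp only [Nat.add_sub_cancel, Nat.sub_self] at this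
      linarith
    have huc : CauchySeq u := by
      refine cauchySeq_of_le_geometric l (|C| * (c * eunorm (x 1 - x 0))) hl.2 fun k => ?_
      have hk := hkey (k + 1) (by omega)
      have hu' := sub_eq_iff_eq_add'.2 (hu (k + 1) (by omega))
      simp only [Nat.add_sub_cancel, Nat.sub_self] at hk hu'
      rw [dist_comm, dist_eq_norm, hu']
      calc _ ≤ C * eunorm (x (k + 1) - x k) := hC _ (hψP _ _ _ _) _
        _ ≤ |C| * (c * l ^ k * eunorm (x 1 - x 0)) :=
          mul_le_mul (le_abs_self C) hk (eunorm_nonneg _) (abs_nonneg C)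
        _ = _ := by ring
    obtain ⟨xl, hxl⟩ := cauchySeq_tendsto_of_complete hxc
    obtain ⟨ul, hul⟩ := cauchySeq_tendsto_of_complete huc
    refine ⟨xl, ul, hxl, hul, tendsto_nhds_unique ((tendsto_add_atTop_iff_nat 1).2 hxl) ?_⟩
    simp only [hx]
    exact (hf.continuous.tendsto _).comp (hxl.prodMk_nhds hul)
  · intro xs us hs ε hε
    refine ⟨1, one_pos, fun x u k₀ hx hu hk₀ hxs hus _ => ?_⟩
    have hk : x k₀ = xs := by
      rw [hs, ← hxs, ← hus, ← hx, Nat.sub_add_cancel hk₀]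
    have hconst : ∀ k, k₀ ≤ k → x k = xs := by
      intro k hkk
      induction k, hkk using Nat.le_induction with
      | base => exact hk
      | succ k hkk ih =>
        have h := key x u hx hu k₀ hk₀ (k + 1) (by omega)
        rw [hk, hxs, sub_self, eunorm_zero, mul_zero] at h
        rw [← ih]
        exact sub_eq_zero.1 (eq_zero_of_eunorm_nonpos h)
    refine ⟨fun k hkk => ?_, ?_⟩
    · rw [hconst k hkk, sub_self, eunorm_zero]
      exact hε.le
    · exact tendsto_atTop_of_eventually_const hconst
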